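/- arXiv:2512.10601 — 2 statements merged into one kernel-verified Lean document; each statement's English description precedes it below -/
import Mathlib

section
/- Let (S,A,P,r) be a finite Markov decision process, let π and π' be stationary policies, let d be a stationary distribution for π and d' a stationary distribution for π', and let (J, V̄) solve the average-reward Poisson equation for π with respect to r with advantage Ā. Set J(π') = Σ_{s,a,s'} d'(s) π'(a|s) P(s'|s,a) r(s,a,s'). Suppose σ ≥ 0 satisfies the distribution-sensitivity bound TV(d'‖d) ≤ σ · Σ_s d(s) TV(π'(·|s)‖π(·|s)), and set ν = σ · max_{s∈S} |Σ_a π'(a|s) Ā(s,a)|. Then L⁻ ≤ J(π') − J ≤ L⁺, where L± = Σ_s d(s) Σ_a π'(a|s) Ā(s,a) ± 2ν Σ_s d(s) TV(π'(·|s)‖π(·|s)). -/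
/-- **Performance difference identity.** For a stationary distribution `μ` of the policy `p`, the
expected one-step advantage relative to any gain `J` and bias `V` is the gain of `p` minus `J`. -/
theorem sum_stationary_advantage {S A : Type*} [Fintype S] [Fintype A]
    (P r : S → A → S → ℝ) (p : S → A → ℝ) (μ : S → ℝ) (J : ℝ) (V : S → ℝ)
    (hP_sum : ∀ s a, ∑ s', P s a s' = 1) (hp_sum : ∀ s, ∑ a, p s a = 1)
    (hμ_sum : ∑ s, μ s = 1)
    (hμ_stat : ∀ s', ∑ s, μ s * ∑ a, p s a * P s a s' = μ s') :
    ∑ s, μ s * ∑ a, p s a * ((∑ s', P s a s' * (r s a s' - J + V s')) - V s)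
      = (∑ s, ∑ a, ∑ s', μ s * p s a * P s a s' * r s a s') - J := by
  have hbias : ∑ s, μ s * ∑ a, p s a * ∑ s', P s a s' * V s' = ∑ s, μ s * V s := by
    calc ∑ s, μ s * ∑ a, p s a * ∑ s', P s a s' * V s'
        = ∑ s, ∑ s', (μ s * ∑ a, p s a * P s a s') * V s' := by
          refine Finset.sum_congr rfl fun s _ => ?_
          simp only [Finset.mul_sum, Finset.sum_mul]
          rw [Finset.sum_comm]
          simp only [mul_assoc]
      _ = ∑ s', μ s' * V s' := by
          rw [Finset.sum_comm]
          simp only [← Finset.sum_mul, hμ_stat]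
  have hstep : ∀ s a, (∑ s', P s a s' * (r s a s' - J + V s')) - V s
      = (∑ s', P s a s' * r s a s') + (∑ s', P s a s' * V s') - (J + V s) := by
    intro s a
    simp only [mul_add, mul_sub, Finset.sum_add_distrib, Finset.sum_sub_distrib,
      ← Finset.sum_mul, hP_sum]
    ring
  have hreward : ∑ s, μ s * ∑ a, p s a * ∑ s', P s a s' * r s a s'
      = ∑ s, ∑ a, ∑ s', μ s * p s a * P s a s' * r s a s' := by
    simp only [Finset.mul_sum, mul_assoc]
  simp_rw [hstep]
  simp only [mul_sub, mul_add, Finset.sum_add_distrib, Finset.sum_sub_distrib,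
    ← Finset.sum_mul, hp_sum, hbias, hreward, one_mul, hμ_sum]
  ring

/-- The expectations of `f` under two weightings differ by at most `max |f|` times their `ℓ¹`
distance. -/
theorem abs_sum_mul_sub_sum_mul_le {S : Type*} [Fintype S] [Nonempty S] (μ ν f : S → ℝ) :
    |∑ s, μ s * f s - ∑ s, ν s * f s|
      ≤ (Finset.univ.sup' Finset.univ_nonempty fun s => |f s|) * ∑ s, |μ s - ν s| := by
  rw [← Finset.sum_sub_distrib, Finset.mul_sum]
  refine (Finset.abs_sum_le_sum_abs _ _).trans (Finset.sum_le_sum fun s _ => ?_)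
  rw [← sub_mul, abs_mul, mul_comm]
  exact mul_le_mul_of_nonneg_right
    (Finset.le_sup' (fun s => |f s|) (Finset.mem_univ s)) (abs_nonneg _)

/-- **Average-reward policy improvement bound (Proposition 3.4 of ACPO).**
`L⁻ ≤ J(π') − J ≤ L⁺` where `L± = Σ_s d(s) Σ_a π'(a|s)Ā(s,a) ± 2ν Σ_s d(s) TV(π'‖π)[s]`
and `ν = σ · max_s |Σ_a π'(a|s)Ā(s,a)|`. -/
theorem stmt_3
    {S A : Type*} [Fintype S] [Nonempty S] [Fintype A]
    (P : S → A → S → ℝ) (r : S → A → S → ℝ)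
    (pol pol' : S → A → ℝ) (d d' : S → ℝ)
    (J : ℝ) (V : S → ℝ) (Q Adv : S → A → ℝ) (σ : ℝ)
    (hP_nonneg : ∀ s a s', 0 ≤ P s a s')
    (hP_sum : ∀ s a, ∑ s', P s a s' = 1)
    (hpol_nonneg : ∀ s a, 0 ≤ pol s a)
    (hpol_sum : ∀ s, ∑ a, pol s a = 1)
    (hpol'_nonneg : ∀ s a, 0 ≤ pol' s a)
    (hpol'_sum : ∀ s, ∑ a, pol' s a = 1)
    (hd_nonneg : ∀ s, 0 ≤ d s)
    (hd_sum : ∑ s, d s = 1)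
    (hd_stat : ∀ s', ∑ s, d s * ∑ a, pol s a * P s a s' = d s')
    (hd'_nonneg : ∀ s, 0 ≤ d' s)
    (hd'_sum : ∑ s, d' s = 1)
    (hd'_stat : ∀ s', ∑ s, d' s * ∑ a, pol' s a * P s a s' = d' s')
    (hQ : ∀ s a, Q s a = ∑ s', P s a s' * (r s a s' - J + V s'))
    (hPoisson : ∀ s, V s = ∑ a, pol s a * Q s a)
    (hAdv : ∀ s a, Adv s a = Q s a - V s)
    (hσ : 0 ≤ σ)
    (hsens : (1 / 2) * ∑ s, |d' s - d s|
      ≤ σ * ∑ s, d s * ((1 / 2) * ∑ a, |pol' s a - pol s a|)) :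
    ((∑ s, d s * ∑ a, pol' s a * Adv s a)
        - 2 * (σ * (Finset.univ.sup' Finset.univ_nonempty
              fun s => |∑ a, pol' s a * Adv s a|))
          * ∑ s, d s * ((1 / 2) * ∑ a, |pol' s a - pol s a|)
      ≤ (∑ s, ∑ a, ∑ s', d' s * pol' s a * P s a s' * r s a s') - J)
    ∧ ((∑ s, ∑ a, ∑ s', d' s * pol' s a * P s a s' * r s a s') - J
      ≤ (∑ s, d s * ∑ a, pol' s a * Adv s a)
        + 2 * (σ * (Finset.univ.sup' Finset.univ_nonempty
              fun s => |∑ a, pol' s a * Adv s a|))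
          * ∑ s, d s * ((1 / 2) * ∑ a, |pol' s a - pol s a|)) := by
  have hgain := sum_stationary_advantage P r pol' d' J V hP_sum hpol'_sum hd'_sum hd'_stat
  simp only [← hQ, ← hAdv] at hgain
  have hdiff := abs_sum_mul_sub_sum_mul_le d' d fun s => ∑ a, pol' s a * Adv s a
  rw [hgain] at hdiff
  have hmax : 0 ≤ Finset.univ.sup' Finset.univ_nonempty fun s => |∑ a, pol' s a * Adv s a| :=
    (abs_nonneg _).trans (Finset.le_sup' (fun s => |∑ a, pol' s a * Adv s a|)
      (Finset.mem_univ (Classical.arbitrary S)))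
  have hscaled := mul_le_mul_of_nonneg_left hsens hmax
  obtain ⟨hlower, hupper⟩ := abs_le.mp hdiff
  constructor <;> linarith
end

section
/- Let (S,A,P) be a finite Markov decision process with a cost function C : S × A × S → ℝ, let π and π' be stationary policies, let d be a stationary distribution for π and d' a stationary distribution for π', and let (J_C, V̄_C) solve the average-reward Poisson equation for π with respect to C with advantage Ā_C. Set J_C(π') = Σ_{s,a,s'} d'(s) π'(a|s) P(s'|s,a) C(s,a,s'). Suppose σ ≥ 0 satisfies TV(d'‖d) ≤ σ · Σ_s d(s) TV(π'(·|s)‖π(·|s)), and set ν_C = σ · max_{s∈S} |Σ_a π'(a|s) Ā_C(s,a)|. Then M⁻ ≤ J_C(π') − J_C ≤ M⁺, where M± = Σ_s d(s) Σ_a π'(a|s) Ā_C(s,a) ± 2ν_C Σ_s d(s) TV(π'(·|s)‖π(·|s)). -/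
open Finset in
/-- The policy average of the advantage in terms of immediate cost, average cost and
expected change of the value function. -/
theorem sum_policy_mul_advantage {S A : Type*} [Fintype S] [Fintype A]
    {P C : S → A → S → ℝ} {pol : S → A → ℝ} {J : ℝ} {V : S → ℝ} {Q Adv : S → A → ℝ}
    (hP : ∀ s a, ∑ s', P s a s' = 1) (hpol : ∀ s, ∑ a, pol s a = 1)
    (hQ : ∀ s a, Q s a = ∑ s', P s a s' * (C s a s' - J + V s'))
    (hAdv : ∀ s a, Adv s a = Q s a - V s) (s : S) :
    ∑ a, pol s a * Adv s a =
      (∑ a, ∑ s', pol s a * P s a s' * C s a s') - J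
        + (∑ s', (∑ a, pol s a * P s a s') * V s') - V s := by
  have hQ' (a : A) : Q s a = (∑ s', P s a s' * C s a s') - J + ∑ s', P s a s' * V s' := by
    rw [hQ]
    simp only [mul_add, mul_sub, sum_add_distrib, sum_sub_distrib, ← sum_mul, hP, one_mul]
  have hswap : ∑ s', (∑ a, pol s a * P s a s') * V s' =
      ∑ a, pol s a * ∑ s', P s a s' * V s' := by
    simp only [sum_mul, mul_sum, mul_assoc]
    exact sum_comm
  rw [hswap]
  simp only [hAdv, hQ', mul_add, mul_sub, sum_add_distrib, sum_sub_distrib, ← sum_mul, hpol,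
    one_mul, mul_assoc, ← mul_sum]

open Finset in
/-- Average-reward performance difference formula. -/
theorem sum_stationary_mul_advantage {S A : Type*} [Fintype S] [Fintype A]
    {P C : S → A → S → ℝ} {pol : S → A → ℝ} {d : S → ℝ} {J : ℝ} {V : S → ℝ}
    {Q Adv : S → A → ℝ}
    (hP : ∀ s a, ∑ s', P s a s' = 1) (hpol : ∀ s, ∑ a, pol s a = 1)
    (hd : ∑ s, d s = 1) (hstat : ∀ s', ∑ s, d s * ∑ a, pol s a * P s a s' = d s')
    (hQ : ∀ s a, Q s a = ∑ s', P s a s' * (C s a s' - J + V s'))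
    (hAdv : ∀ s a, Adv s a = Q s a - V s) :
    ∑ s, d s * ∑ a, pol s a * Adv s a =
      (∑ s, ∑ a, ∑ s', d s * pol s a * P s a s' * C s a s') - J := by
  have hV : ∑ s, d s * ∑ s', (∑ a, pol s a * P s a s') * V s' = ∑ s, d s * V s := by
    calc
      _ = ∑ s', (∑ s, d s * ∑ a, pol s a * P s a s') * V s' := by
        simp only [mul_sum (s := univ (α := S)), sum_mul (s := univ (α := S)), ← mul_assoc]
        exact sum_comm
      _ = ∑ s, d s * V s := by simp only [hstat]
  have hC : ∑ s, ∑ a, ∑ s', d s * pol s a * P s a s' * C s a s' =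
      ∑ s, d s * ∑ a, ∑ s', pol s a * P s a s' * C s a s' := by
    simp only [mul_sum, mul_assoc]
  rw [hC]
  simp only [sum_policy_mul_advantage hP hpol hQ hAdv, mul_add, mul_sub, sum_add_distrib,
    sum_sub_distrib, ← sum_mul, hd, hV]
  ring

open Finset in
/-- Hölder's inequality between the `ℓ¹` and `ℓ^∞` norms on a finite type. -/
theorem abs_sum_sub_mul_le_sum_abs_mul_sup {S : Type*} [Fintype S] [Nonempty S]
    (p q g : S → ℝ) :
    |∑ s, p s * g s - ∑ s, q s * g s| ≤
      (∑ s, |p s - q s|) * univ.sup' univ_nonempty fun s => |g s| := by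
  rw [← sum_sub_distrib, sum_mul]
  refine (abs_sum_le_sum_abs _ _).trans (sum_le_sum fun s _ => ?_)
  rw [← sub_mul, abs_mul]
  gcongr
  exact le_sup' (fun s => |g s|) (mem_univ s)

/-- **Average-cost constraint bound (Corollary of the ACPO improvement bound).**
`M⁻ ≤ J_C(π') − J_C ≤ M⁺` where `M± = Σ_s d(s) Σ_a π'(a|s)Ā_C(s,a) ± 2ν_C Σ_s d(s) TV(π'‖π)[s]`
and `ν_C = σ · max_s |Σ_a π'(a|s)Ā_C(s,a)|`. -/
theorem stmt_4
    {S A : Type*} [Fintype S] [Nonempty S] [Fintype A]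
    (P : S → A → S → ℝ) (C : S → A → S → ℝ)
    (pol pol' : S → A → ℝ) (d d' : S → ℝ)
    (JC : ℝ) (VC : S → ℝ) (QC AdvC : S → A → ℝ) (σ : ℝ)
    (hP_nonneg : ∀ s a s', 0 ≤ P s a s')
    (hP_sum : ∀ s a, ∑ s', P s a s' = 1)
    (hpol_nonneg : ∀ s a, 0 ≤ pol s a)
    (hpol_sum : ∀ s, ∑ a, pol s a = 1)
    (hpol'_nonneg : ∀ s a, 0 ≤ pol' s a)
    (hpol'_sum : ∀ s, ∑ a, pol' s a = 1)
    (hd_nonneg : ∀ s, 0 ≤ d s)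
    (hd_sum : ∑ s, d s = 1)
    (hd_stat : ∀ s', ∑ s, d s * ∑ a, pol s a * P s a s' = d s')
    (hd'_nonneg : ∀ s, 0 ≤ d' s)
    (hd'_sum : ∑ s, d' s = 1)
    (hd'_stat : ∀ s', ∑ s, d' s * ∑ a, pol' s a * P s a s' = d' s')
    (hQC : ∀ s a, QC s a = ∑ s', P s a s' * (C s a s' - JC + VC s'))
    (hPoissonC : ∀ s, VC s = ∑ a, pol s a * QC s a)
    (hAdvC : ∀ s a, AdvC s a = QC s a - VC s)
    (hσ : 0 ≤ σ)
    (hsens : (1 / 2) * ∑ s, |d' s - d s|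
      ≤ σ * ∑ s, d s * ((1 / 2) * ∑ a, |pol' s a - pol s a|)) :
    ((∑ s, d s * ∑ a, pol' s a * AdvC s a)
        - 2 * (σ * (Finset.univ.sup' Finset.univ_nonempty
              fun s => |∑ a, pol' s a * AdvC s a|))
          * ∑ s, d s * ((1 / 2) * ∑ a, |pol' s a - pol s a|)
      ≤ (∑ s, ∑ a, ∑ s', d' s * pol' s a * P s a s' * C s a s') - JC)
    ∧ ((∑ s, ∑ a, ∑ s', d' s * pol' s a * P s a s' * C s a s') - JC
      ≤ (∑ s, d s * ∑ a, pol' s a * AdvC s a)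
        + 2 * (σ * (Finset.univ.sup' Finset.univ_nonempty
              fun s => |∑ a, pol' s a * AdvC s a|))
          * ∑ s, d s * ((1 / 2) * ∑ a, |pol' s a - pol s a|)) := by
  have hdiff := abs_sum_sub_mul_le_sum_abs_mul_sup d' d fun s => ∑ a, pol' s a * AdvC s a
  rw [sum_stationary_mul_advantage hP_sum hpol'_sum hd'_sum hd'_stat hQC hAdvC] at hdiff
  have hM : 0 ≤ Finset.univ.sup' Finset.univ_nonempty fun s => |∑ a, pol' s a * AdvC s a| :=
    (abs_nonneg _).trans (Finset.le_sup' (fun s => |∑ a, pol' s a * AdvC s a|)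
      (Finset.mem_univ (Classical.arbitrary S)))
  have hbound := abs_le.mp (hdiff.trans (mul_le_mul_of_nonneg_right
    (by linarith : _ ≤ 2 * (σ * ∑ s, d s * ((1 / 2) * ∑ a, |pol' s a - pol s a|))) hM))
  constructor <;> linarith [hbound.1, hbound.2]
end
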